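/- Let (X,w) be a Euclidean 6-design in ℝ^22 supported by exactly two concentric spheres of positive radii r1, r2 centered at the origin, with fibers X1 and X2, |X| = 2300 and |X1| = 275 (so |X2| = 2025). Then the set A(X2,X2) = { (x·y)/r2² : x, y ∈ X2, x ≠ y } of normalized inner products between distinct points of X2 equals {7/22, −1/44, −4/11}; in particular X2 is a 3-distance set. -/

import Mathlib

open MeasureTheory Metric MvPolynomial
open scoped RealInnerProductSpace Classical

/-- Average of a polynomial over the sphere of radius `r` centered at the origin in `ℝⁿ`,
with respect to the (rotation-invariant, normalized) surface measure. -/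
noncomputable def sphereAvg (n : ℕ) (r : ℝ) (f : MvPolynomial (Fin n) ℝ) : ℝ :=
  ⨍ u : sphere (0 : EuclideanSpace ℝ (Fin n)) 1,
    eval (fun i => r * (u : EuclideanSpace ℝ (Fin n)) i) f
    ∂((volume : Measure (EuclideanSpace ℝ (Fin n))).toSphere)

/-- `(X₁ ∪ X₂, w)` is a Euclidean `t`-design of `ℝ²²` supported by the two concentric spheres
of radii `r₁` and `r₂` centered at the origin, with fibers `X₁ ⊆ S(0,r₁)` and `X₂ ⊆ S(0,r₂)`. -/
def IsEuclideanDesignTwoSpheres (t : ℕ) (X₁ X₂ : Finset (EuclideanSpace ℝ (Fin 22)))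
    (w : EuclideanSpace ℝ (Fin 22) → ℝ) (r₁ r₂ : ℝ) : Prop :=
  ∀ f : MvPolynomial (Fin 22) ℝ, f.totalDegree ≤ t →
    (∑ x ∈ X₁, w x) * sphereAvg 22 r₁ f + (∑ x ∈ X₂, w x) * sphereAvg 22 r₂ f
      = ∑ x ∈ X₁ ∪ X₂, w x * eval (x : Fin 22 → ℝ) f

section SphereMoments

variable {E : Type*} [NormedAddCommGroup E] [InnerProductSpace ℝ E]

/-- The self-map of the unit sphere induced by a linear isometry equivalence. -/
def sphereMap (L : E ≃ₗᵢ[ℝ] E) (u : sphere (0 : E) 1) : sphere (0 : E) 1 :=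
  ⟨L u, by simp⟩

theorem continuous_sphereMap (L : E ≃ₗᵢ[ℝ] E) : Continuous (sphereMap L) :=
  Continuous.subtype_mk (L.continuous.comp continuous_subtype_val) _

/-- The function `u ↦ ⟪x, u⟫` on the unit sphere. -/
def innerOnSphere (x : E) : C(sphere (0 : E) 1, ℝ) :=
  ⟨fun u => ⟪x, (u : E)⟫, by fun_prop⟩

theorem innerOnSphere_apply (x : E) (u : sphere (0 : E) 1) :
    innerOnSphere x u = ⟪x, (u : E)⟫ := rfl

theorem norm_add_smul_sq_of_unit {e f : E} (he : ‖e‖ = 1) (hf : ‖f‖ = 1) (s : ℝ) :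
    ‖e + s • f‖ ^ 2 = 1 + s ^ 2 + 2 * s * ⟪e, f⟫ := by
  rw [norm_add_sq_real, norm_smul, inner_smul_right, he, hf, Real.norm_eq_abs, mul_one, sq_abs]
  ring

variable [MeasurableSpace E] [BorelSpace E] [FiniteDimensional ℝ E]

theorem map_sphereMap_toSphere (L : E ≃ₗᵢ[ℝ] E) :
    (volume : Measure E).toSphere.map (sphereMap L) = (volume : Measure E).toSphere := by
  ext s hs
  have hm := (continuous_sphereMap L).measurable
  rw [Measure.map_apply hm hs, Measure.toSphere_apply' _ hs, Measure.toSphere_apply' _ (hm hs)]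
  congr 1
  symm
  rw [← L.measurePreserving.measure_preimage_equiv (f := L.toMeasurableEquiv)]
  congr 1
  ext z
  simp only [Set.mem_smul, Set.mem_image, Set.mem_preimage]
  constructor
  · rintro ⟨c, hc, _, ⟨u, hu, rfl⟩, h⟩
    refine ⟨c, hc, _, ⟨sphereMap L.symm u, ?_, rfl⟩, ?_⟩
    · simpa [sphereMap] using hu
    · apply L.injective
      simpa [sphereMap] using h
  · rintro ⟨c, hc, _, ⟨u, hu, rfl⟩, rfl⟩
    exact ⟨c, hc, _, ⟨sphereMap L u, hu, rfl⟩, by simp [sphereMap]⟩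

theorem integrable_toSphere (f : C(sphere (0 : E) 1, ℝ)) :
    Integrable f (volume : Measure E).toSphere :=
  f.continuous.integrable_of_hasCompactSupport (HasCompactSupport.of_compactSpace f)

variable (E) in
/-- Averaging over the unit sphere, as a linear functional on continuous functions. -/
noncomputable def sphereMean : C(sphere (0 : E) 1, ℝ) →ₗ[ℝ] ℝ where
  toFun f := ⨍ u, f u ∂(volume : Measure E).toSphere
  map_add' f g := by
    simp only [average_eq, ContinuousMap.add_apply,
      integral_add (integrable_toSphere f) (integrable_toSphere g), smul_add]
  map_smul' c f := by
    simp only [average_eq, ContinuousMap.smul_apply, integral_smul, RingHom.id_apply]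
    exact smul_comm _ _ _

theorem sphereMean_one [Nontrivial E] : sphereMean E 1 = 1 := by
  have : NeZero (volume : Measure E).toSphere := ⟨Measure.toSphere_ne_zero _⟩
  exact average_const _ (1 : ℝ)

/-- The average over the unit sphere of the `k`-th power of the inner product with `x`. -/
noncomputable def sphereMoment (k : ℕ) (x : E) : ℝ := sphereMean E (innerOnSphere x ^ k)

theorem sphereMoment_map (k : ℕ) (L : E ≃ₗᵢ[ℝ] E) (x : E) :
    sphereMoment k (L x) = sphereMoment k x := by
  have hc (y : E) : Continuous fun u : sphere (0 : E) 1 => ⟪y, (u : E)⟫ ^ k := by fun_prop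
  change ⨍ u : sphere (0 : E) 1, ⟪L x, (u : E)⟫ ^ k ∂(volume : Measure E).toSphere
    = ⨍ u : sphere (0 : E) 1, ⟪x, (u : E)⟫ ^ k ∂(volume : Measure E).toSphere
  simp only [average_eq]
  congr 1
  conv_lhs => rw [← map_sphereMap_toSphere L]
  rw [integral_map (continuous_sphereMap L).measurable.aemeasurable
    (hc _).aestronglyMeasurable]
  simp [sphereMap]

theorem sphereMoment_smul (k : ℕ) (a : ℝ) (x : E) :
    sphereMoment k (a • x) = a ^ k * sphereMoment k x := by
  have : innerOnSphere (a • x) ^ k = a ^ k • innerOnSphere x ^ k := by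
    ext u
    simp [innerOnSphere_apply, inner_smul_left, mul_pow]
  rw [sphereMoment, this, map_smul, smul_eq_mul, sphereMoment]

theorem sphereMoment_eq_norm_pow (k : ℕ) {e : E} (he : ‖e‖ = 1) (x : E) :
    sphereMoment k x = ‖x‖ ^ k * sphereMoment k e := by
  have h : ‖x‖ = ‖‖x‖ • e‖ := by simp [norm_smul, he]
  rw [← sphereMoment_smul, ← sphereMoment_map k (Submodule.reflection (ℝ ∙ (x - ‖x‖ • e))ᗮ) x,
    Submodule.reflection_sub h]

theorem sphereMoment_of_odd {k : ℕ} (hk : Odd k) (x : E) : sphereMoment k x = 0 := by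
  have h := sphereMoment_map k (LinearIsometryEquiv.neg ℝ) x
  have h' := sphereMoment_smul k (-1) x
  simp only [LinearIsometryEquiv.coe_neg, neg_one_smul, hk.neg_one_pow] at h h'
  linarith

theorem sphereMean_sq_mul_sq (x y : E) :
    12 * sphereMean E (innerOnSphere x ^ 2 * innerOnSphere y ^ 2)
      = sphereMoment 4 (x + y) + sphereMoment 4 (x - y)
        - 2 * sphereMoment 4 x - 2 * sphereMoment 4 y := by
  simp only [sphereMoment, ← smul_eq_mul (a := (_ : ℝ)), ← map_smul, ← map_add, ← map_sub]
  congr 1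
  ext u
  simp only [ContinuousMap.smul_apply, ContinuousMap.mul_apply, ContinuousMap.pow_apply,
    ContinuousMap.add_apply, ContinuousMap.sub_apply, innerOnSphere_apply, inner_add_left,
    inner_sub_left, smul_eq_mul]
  ring

theorem sphereMean_pow_four_mul_sq (x y : E) :
    360 * sphereMean E (innerOnSphere x ^ 4 * innerOnSphere y ^ 2)
      = 16 * (sphereMoment 6 (x + y) + sphereMoment 6 (x - y))
        - (sphereMoment 6 (x + (2 : ℝ) • y) + sphereMoment 6 (x - (2 : ℝ) • y))
        - 30 * sphereMoment 6 x + 96 * sphereMoment 6 y := by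
  simp only [sphereMoment, ← smul_eq_mul (a := (_ : ℝ)), ← map_smul, ← map_add, ← map_sub]
  congr 1
  ext u
  simp only [ContinuousMap.smul_apply, ContinuousMap.mul_apply, ContinuousMap.pow_apply,
    ContinuousMap.add_apply, ContinuousMap.sub_apply, innerOnSphere_apply, inner_add_left,
    inner_sub_left, inner_smul_left, smul_eq_mul, conj_trivial]
  ring

variable {ι : Type*} [Fintype ι]

theorem sum_sphereMean_mul_sq (b : OrthonormalBasis ι ℝ E) (f : C(sphere (0 : E) 1, ℝ)) :
    ∑ i, sphereMean E (f * innerOnSphere (b i) ^ 2) = sphereMean E f := by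
  rw [← map_sum]
  congr 1
  ext u
  have h := b.sum_sq_inner_right (u : E)
  simp only [norm_eq_of_mem_sphere, one_pow] at h
  simp [innerOnSphere_apply, ← Finset.mul_sum, h]

theorem sphereMoment_two [Nontrivial E] (b : OrthonormalBasis ι ℝ E) (x : E) :
    sphereMoment 2 x = ‖x‖ ^ 2 / Fintype.card ι := by
  obtain ⟨e, he⟩ := exists_norm_eq E (zero_le_one' ℝ)
  have h := sum_sphereMean_mul_sq b 1
  have h1 (i : ι) : sphereMean E (1 * innerOnSphere (b i) ^ 2) = sphereMoment 2 e := by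
    rw [one_mul, ← sphereMoment, sphereMoment_eq_norm_pow 2 he]
    simp
  simp only [h1, sphereMean_one, Finset.sum_const, Finset.card_univ, nsmul_eq_mul] at h
  rw [sphereMoment_eq_norm_pow 2 he, eq_div_iff (left_ne_zero_of_mul_eq_one h)]
  linear_combination ‖x‖ ^ 2 * h

theorem sphereMoment_four [Nontrivial E] (b : OrthonormalBasis ι ℝ E) (x : E) :
    sphereMoment 4 x = 3 * ‖x‖ ^ 4 / (Fintype.card ι * (Fintype.card ι + 2)) := by
  obtain ⟨e, he⟩ := exists_norm_eq E (zero_le_one' ℝ)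
  have hcard : (Fintype.card ι : ℝ) ≠ 0 := by
    have := b.toBasis.index_nonempty
    exact_mod_cast Fintype.card_ne_zero
  have h := sum_sphereMean_mul_sq b (innerOnSphere e ^ 2)
  rw [← sphereMoment, sphereMoment_two b e, he] at h
  have h1 (i : ι) : sphereMean E (innerOnSphere e ^ 2 * innerOnSphere (b i) ^ 2)
      = sphereMoment 4 e * (1 / 3 + 2 / 3 * ⟪e, b i⟫ ^ 2) := by
    have hm := sphereMean_sq_mul_sq e (b i)
    have hp := norm_add_smul_sq_of_unit he (b.norm_eq_one i) 1
    have hn := norm_add_smul_sq_of_unit he (b.norm_eq_one i) (-1)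
    rw [one_smul] at hp
    rw [neg_one_smul, ← sub_eq_add_neg] at hn
    rw [sphereMoment_eq_norm_pow 4 he (e + b i), sphereMoment_eq_norm_pow 4 he (e - b i),
      sphereMoment_eq_norm_pow 4 he (b i), b.norm_eq_one, pow_mul _ 2 2, pow_mul _ 2 2, hp, hn]
      at hm
    linear_combination hm / 12
  simp only [h1, ← Finset.mul_sum, Finset.sum_add_distrib, b.sum_sq_inner_left, he,
    Finset.sum_const, Finset.card_univ, nsmul_eq_mul] at h
  rw [sphereMoment_eq_norm_pow 4 he, eq_div_iff (by positivity)]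
  field_simp at h
  linear_combination ‖x‖ ^ 4 * h

theorem sphereMoment_six [Nontrivial E] (b : OrthonormalBasis ι ℝ E) (x : E) :
    sphereMoment 6 x = 15 * ‖x‖ ^ 6
      / (Fintype.card ι * (Fintype.card ι + 2) * (Fintype.card ι + 4)) := by
  obtain ⟨e, he⟩ := exists_norm_eq E (zero_le_one' ℝ)
  have hcard : (Fintype.card ι : ℝ) ≠ 0 := by
    have := b.toBasis.index_nonempty
    exact_mod_cast Fintype.card_ne_zero
  have h := sum_sphereMean_mul_sq b (innerOnSphere e ^ 4)
  rw [← sphereMoment, sphereMoment_four b e, he] at h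
  have h1 (i : ι) : sphereMean E (innerOnSphere e ^ 4 * innerOnSphere (b i) ^ 2)
      = sphereMoment 6 e * (1 / 5 + 4 / 5 * ⟪e, b i⟫ ^ 2) := by
    have hm := sphereMean_pow_four_mul_sq e (b i)
    have hp := norm_add_smul_sq_of_unit he (b.norm_eq_one i) 1
    have hn := norm_add_smul_sq_of_unit he (b.norm_eq_one i) (-1)
    have hp2 := norm_add_smul_sq_of_unit he (b.norm_eq_one i) 2
    have hn2 := norm_add_smul_sq_of_unit he (b.norm_eq_one i) (-2)
    rw [one_smul] at hp
    rw [neg_one_smul, ← sub_eq_add_neg] at hn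
    rw [neg_smul, ← sub_eq_add_neg] at hn2
    rw [sphereMoment_eq_norm_pow 6 he (e + b i), sphereMoment_eq_norm_pow 6 he (e - b i),
      sphereMoment_eq_norm_pow 6 he (e + (2 : ℝ) • b i),
      sphereMoment_eq_norm_pow 6 he (e - (2 : ℝ) • b i),
      sphereMoment_eq_norm_pow 6 he (b i), b.norm_eq_one, pow_mul _ 2 3, pow_mul _ 2 3,
      pow_mul _ 2 3, pow_mul _ 2 3, hp, hn, hp2, hn2] at hm
    linear_combination hm / 360
  simp only [h1, ← Finset.mul_sum, Finset.sum_add_distrib, b.sum_sq_inner_left, he,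
    Finset.sum_const, Finset.card_univ, nsmul_eq_mul] at h
  rw [sphereMoment_eq_norm_pow 6 he, eq_div_iff (by positivity)]
  field_simp at h
  linear_combination ‖x‖ ^ 6 * h

end SphereMoments

section DesignMoments

/-- The linear form `z ↦ ⟪x, z⟫` as a polynomial. -/
noncomputable def linearForm {n : ℕ} (x : EuclideanSpace ℝ (Fin n)) : MvPolynomial (Fin n) ℝ :=
  ∑ i, C (x i) * X i

/-- The squared norm `z ↦ ‖z‖²` as a polynomial. -/
noncomputable def normSqForm (n : ℕ) : MvPolynomial (Fin n) ℝ := ∑ i, X i ^ 2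

theorem eval_linearForm {n : ℕ} (x z : EuclideanSpace ℝ (Fin n)) :
    eval (z : Fin n → ℝ) (linearForm x) = ⟪x, z⟫ := by
  simp [linearForm, PiLp.inner_apply, mul_comm]

theorem eval_normSqForm {n : ℕ} (z : EuclideanSpace ℝ (Fin n)) :
    eval (z : Fin n → ℝ) (normSqForm n) = ‖z‖ ^ 2 := by
  simp [normSqForm, EuclideanSpace.real_norm_sq_eq]

theorem totalDegree_linearForm_pow_mul_normSqForm_pow {n : ℕ} (x : EuclideanSpace ℝ (Fin n))
    (k l : ℕ) : (linearForm x ^ k * normSqForm n ^ l).totalDegree ≤ k + 2 * l := by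
  have h1 : (linearForm x).totalDegree ≤ 1 := by
    refine totalDegree_finsetSum_le fun i _ => (totalDegree_mul _ _).trans ?_
    simp [totalDegree_X]
  have h2 : (normSqForm n).totalDegree ≤ 2 := by
    refine totalDegree_finsetSum_le fun i _ => (totalDegree_pow _ _).trans ?_
    simp [totalDegree_X]
  calc (linearForm x ^ k * normSqForm n ^ l).totalDegree
      ≤ (linearForm x ^ k).totalDegree + (normSqForm n ^ l).totalDegree := totalDegree_mul _ _
    _ ≤ k * (linearForm x).totalDegree + l * (normSqForm n).totalDegree :=
        add_le_add (totalDegree_pow _ _) (totalDegree_pow _ _)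
    _ ≤ k + 2 * l := by nlinarith

theorem sphereAvg_linearForm_pow_mul_normSqForm_pow {n : ℕ} (r : ℝ)
    (x : EuclideanSpace ℝ (Fin n)) (k l : ℕ) :
    sphereAvg n r (linearForm x ^ k * normSqForm n ^ l) = r ^ (k + 2 * l) * sphereMoment k x := by
  rw [sphereMoment, ← smul_eq_mul (r ^ (k + 2 * l)), ← map_smul]
  refine congrArg (average (volume : Measure (EuclideanSpace ℝ (Fin n))).toSphere)
    (_root_.funext fun u => ?_)
  change eval (((r • (u : EuclideanSpace ℝ (Fin n)) : EuclideanSpace ℝ (Fin n))) : Fin n → ℝ) _ = _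
  simp only [map_mul, map_pow, eval_linearForm, eval_normSqForm, norm_smul, norm_eq_of_mem_sphere,
    inner_smul_right, ContinuousMap.smul_apply, ContinuousMap.pow_apply, innerOnSphere_apply,
    smul_eq_mul, mul_one, Real.norm_eq_abs, sq_abs]
  ring

variable {X₁ X₂ : Finset (EuclideanSpace ℝ (Fin 22))} {w : EuclideanSpace ℝ (Fin 22) → ℝ}
  {r₁ r₂ : ℝ}

theorem disjoint_of_norm_eq (hrne : r₁ ≠ r₂) (hX₁ : ∀ x ∈ X₁, ‖x‖ = r₁)
    (hX₂ : ∀ x ∈ X₂, ‖x‖ = r₂) : Disjoint X₁ X₂ :=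
  Finset.disjoint_left.2 fun x h1 h2 => hrne ((hX₁ x h1).symm.trans (hX₂ x h2))

theorem IsEuclideanDesignTwoSpheres.sum_moments {t : ℕ}
    (h : IsEuclideanDesignTwoSpheres t X₁ X₂ w r₁ r₂) (hdisj : Disjoint X₁ X₂)
    (hX₁ : ∀ x ∈ X₁, ‖x‖ = r₁) (hX₂ : ∀ x ∈ X₂, ‖x‖ = r₂) {k l : ℕ} (hkl : k + 2 * l ≤ t)
    (x : EuclideanSpace ℝ (Fin 22)) :
    r₁ ^ (2 * l) * ∑ z ∈ X₁, w z * ⟪x, z⟫ ^ k + r₂ ^ (2 * l) * ∑ z ∈ X₂, w z * ⟪x, z⟫ ^ k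
      = ((∑ z ∈ X₁, w z) * r₁ ^ (k + 2 * l) + (∑ z ∈ X₂, w z) * r₂ ^ (k + 2 * l))
        * sphereMoment k x := by
  have := h (linearForm x ^ k * normSqForm 22 ^ l)
    ((totalDegree_linearForm_pow_mul_normSqForm_pow x k l).trans hkl)
  rw [sphereAvg_linearForm_pow_mul_normSqForm_pow, sphereAvg_linearForm_pow_mul_normSqForm_pow,
    Finset.sum_union hdisj] at this
  have e (X : Finset (EuclideanSpace ℝ (Fin 22))) (r : ℝ) (hX : ∀ x ∈ X, ‖x‖ = r) :
      ∑ z ∈ X, w z * eval (z : Fin 22 → ℝ) (linearForm x ^ k * normSqForm 22 ^ l)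
        = r ^ (2 * l) * ∑ z ∈ X, w z * ⟪x, z⟫ ^ k := by
    rw [Finset.mul_sum]
    refine Finset.sum_congr rfl fun z hz => ?_
    rw [map_mul, map_pow, map_pow, eval_linearForm, eval_normSqForm, hX z hz]
    ring
  rw [e X₁ r₁ hX₁, e X₂ r₂ hX₂] at this
  linear_combination -this

/-- The moments of degree at most `t - 2` of a Euclidean `t`-design on two spheres of different
radii agree, on each fiber separately, with those of the sphere. -/
theorem IsEuclideanDesignTwoSpheres.fiber_moments {t : ℕ}
    (h : IsEuclideanDesignTwoSpheres t X₁ X₂ w r₁ r₂) (hr₁ : 0 < r₁) (hr₂ : 0 < r₂)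
    (hrne : r₁ ≠ r₂) (hX₁ : ∀ x ∈ X₁, ‖x‖ = r₁) (hX₂ : ∀ x ∈ X₂, ‖x‖ = r₂)
    {k : ℕ} (hk : k + 2 ≤ t) (x : EuclideanSpace ℝ (Fin 22)) :
    ∑ z ∈ X₁, w z * ⟪x, z⟫ ^ k = (∑ z ∈ X₁, w z) * r₁ ^ k * sphereMoment k x ∧
      ∑ z ∈ X₂, w z * ⟪x, z⟫ ^ k = (∑ z ∈ X₂, w z) * r₂ ^ k * sphereMoment k x := by
  have hd := disjoint_of_norm_eq hrne hX₁ hX₂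
  have h0 := h.sum_moments hd hX₁ hX₂ (k := k) (l := 0) (by omega) x
  have h1 := h.sum_moments hd hX₁ hX₂ (k := k) (l := 1) (by omega) x
  have hne : r₁ ^ 2 - r₂ ^ 2 ≠ 0 := by
    rw [sq_sub_sq]
    exact mul_ne_zero (by positivity) (sub_ne_zero.2 hrne)
  constructor <;> apply mul_left_cancel₀ hne
  · linear_combination h1 - r₂ ^ 2 * h0
  · linear_combination r₁ ^ 2 * h0 - h1

end DesignMoments

section Kernel

/-- The reproducing kernel of the polynomials of degree at most `3` on two concentric spheres in
`ℝ²²`, at two points of inner product `t` on the same sphere, of radius `r` and total weight `W`. -/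
noncomputable def kernelSame (A₂ A₃ W r t : ℝ) : ℝ :=
  2288 / A₃ * (t ^ 3 - r ^ 4 / 8 * t) + 264 / A₂ * (t ^ 2 - r ^ 4 / 22)
    + 22 / (r ^ 2 * W) * t + 1 / W

/-- The same reproducing kernel, at two points of inner product `t` on different spheres, of
radii `r` and `s`. -/
noncomputable def kernelCross (A₂ A₃ r s t : ℝ) : ℝ :=
  2288 / A₃ * (t ^ 3 - r ^ 2 * s ^ 2 / 8 * t) + 264 / A₂ * (t ^ 2 - r ^ 2 * s ^ 2 / 22)

theorem kernelSame_diag {A₂ A₃ W r : ℝ} (hr : r ≠ 0) :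
    kernelSame A₂ A₃ W r (r ^ 2) = 2002 * r ^ 6 / A₃ + 252 * r ^ 4 / A₂ + 23 / W := by
  rw [kernelSame, ← div_div]
  field_simp
  ring

theorem sum_mul_cubic_sq {ι : Type*} (s : Finset ι) (w t : ι → ℝ) (a b c d : ℝ) :
    ∑ z ∈ s, w z * (a * t z ^ 3 + b * t z ^ 2 + c * t z + d) ^ 2
      = a ^ 2 * ∑ z ∈ s, w z * t z ^ 6 + 2 * a * b * ∑ z ∈ s, w z * t z ^ 5
        + (b ^ 2 + 2 * a * c) * ∑ z ∈ s, w z * t z ^ 4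
        + (2 * a * d + 2 * b * c) * ∑ z ∈ s, w z * t z ^ 3
        + (c ^ 2 + 2 * b * d) * ∑ z ∈ s, w z * t z ^ 2
        + 2 * c * d * ∑ z ∈ s, w z * t z ^ 1 + d ^ 2 * ∑ z ∈ s, w z * t z ^ 0 := by
  simp only [Finset.mul_sum, ← Finset.sum_add_distrib]
  exact Finset.sum_congr rfl fun z _ => by ring

theorem kernel_reproducing_identity {A₂ A₃ W₁ W₂ r₁ r₂ a b c d c' d' : ℝ}
    (hr₁ : r₁ ≠ 0) (hW₁ : W₁ ≠ 0) (hA₂ : A₂ ≠ 0) (hA₃ : A₃ ≠ 0)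
    (eA₂ : A₂ = W₁ * r₁ ^ 4 + W₂ * r₂ ^ 4) (eA₃ : A₃ = W₁ * r₁ ^ 6 + W₂ * r₂ ^ 6)
    (ha : a = 2288 / A₃) (hb : b = 264 / A₂) (hc : c = 22 / (r₁ ^ 2 * W₁) - a * r₁ ^ 4 / 8)
    (hd : d = 1 / W₁ - b * r₁ ^ 4 / 22) (hc' : c' = -(a * (r₁ ^ 2 * r₂ ^ 2 / 8)))
    (hd' : d' = -(b * (r₁ ^ 2 * r₂ ^ 2 / 22))) :
    a ^ 2 * (A₃ * (15 * r₁ ^ 6 / 13728))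
      + (b ^ 2 + 2 * a * c) * (W₁ * r₁ ^ 4 * (3 * r₁ ^ 4 / 528))
      + (b ^ 2 + 2 * a * c') * (W₂ * r₂ ^ 4 * (3 * r₁ ^ 4 / 528))
      + (c ^ 2 + 2 * b * d) * (W₁ * r₁ ^ 2 * (r₁ ^ 2 / 22))
      + (c' ^ 2 + 2 * b * d') * (W₂ * r₂ ^ 2 * (r₁ ^ 2 / 22))
      + d ^ 2 * W₁ + d' ^ 2 * W₂
      = 2002 * r₁ ^ 6 / A₃ + 252 * r₁ ^ 4 / A₂ + 23 / W₁ := by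
  have h3 : a * A₃ = 2288 := by rw [ha]; field_simp
  have h2 : b * A₂ = 264 := by rw [hb]; field_simp
  have e3 : 2002 * r₁ ^ 6 / A₃ = a * r₁ ^ 6 * 7 / 8 := by rw [ha]; ring
  have e2 : 252 * r₁ ^ 4 / A₂ = b * r₁ ^ 4 * 21 / 22 := by rw [hb]; ring
  obtain ⟨v, hv⟩ : ∃ v, v * (r₁ ^ 2 * W₁) = 1 := ⟨_, inv_mul_cancel₀ (by positivity)⟩
  have hv1 : 22 / (r₁ ^ 2 * W₁) = 22 * v := by rw [eq_comm, eq_div_iff (by positivity)]; linarith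
  have hv2 : 1 / W₁ = v * r₁ ^ 2 := by rw [eq_comm, eq_div_iff hW₁]; linarith
  rw [e3, e2, hc, hd, hc', hd', hv1, ← mul_one_div 23, hv2]
  rw [eA₃] at h3 ⊢
  rw [eA₂] at h2
  linear_combination 7 / 18304 * a * r₁ ^ 6 * h3 + 7 / 1936 * b * r₁ ^ 4 * h2
    + 23 * v * r₁ ^ 2 * hv

variable {X₁ X₂ : Finset (EuclideanSpace ℝ (Fin 22))} {w : EuclideanSpace ℝ (Fin 22) → ℝ}
  {r₁ r₂ : ℝ}

theorem IsEuclideanDesignTwoSpheres.symm {t : ℕ}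
    (h : IsEuclideanDesignTwoSpheres t X₁ X₂ w r₁ r₂) :
    IsEuclideanDesignTwoSpheres t X₂ X₁ w r₂ r₁ := fun f hf => by
  rw [add_comm, Finset.union_comm, h f hf]

theorem IsEuclideanDesignTwoSpheres.sum_kernel_sq
    (h : IsEuclideanDesignTwoSpheres 6 X₁ X₂ w r₁ r₂) (hr₁ : 0 < r₁) (hr₂ : 0 < r₂)
    (hrne : r₁ ≠ r₂) (hX₁ : ∀ x ∈ X₁, ‖x‖ = r₁) (hX₂ : ∀ x ∈ X₂, ‖x‖ = r₂)
    {A₂ A₃ W₁ W₂ : ℝ} (hW₁ : 0 < W₁) (hW₂ : 0 < W₂) (eW₁ : W₁ = ∑ z ∈ X₁, w z)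
    (eW₂ : W₂ = ∑ z ∈ X₂, w z)
    (eA₂ : A₂ = W₁ * r₁ ^ 4 + W₂ * r₂ ^ 4) (eA₃ : A₃ = W₁ * r₁ ^ 6 + W₂ * r₂ ^ 6)
    {x : EuclideanSpace ℝ (Fin 22)} (hx : ‖x‖ = r₁) :
    ∑ z ∈ X₁, w z * kernelSame A₂ A₃ W₁ r₁ ⟪x, z⟫ ^ 2
      + ∑ z ∈ X₂, w z * kernelCross A₂ A₃ r₁ r₂ ⟪x, z⟫ ^ 2
      = kernelSame A₂ A₃ W₁ r₁ (r₁ ^ 2) := by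
  have hd := disjoint_of_norm_eq hrne hX₁ hX₂
  have b := EuclideanSpace.basisFun (Fin 22) ℝ
  have m0 : sphereMoment 0 x = 1 := by rw [sphereMoment, pow_zero, sphereMean_one]
  have m1 : sphereMoment 1 x = 0 := sphereMoment_of_odd (by decide) x
  have m2 : sphereMoment 2 x = r₁ ^ 2 / 22 := by
    rw [sphereMoment_two b, hx, Fintype.card_fin]; norm_num
  have m3 : sphereMoment 3 x = 0 := sphereMoment_of_odd (by decide) x
  have m4 : sphereMoment 4 x = 3 * r₁ ^ 4 / 528 := by
    rw [sphereMoment_four b, hx, Fintype.card_fin]; norm_num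
  have m5 : sphereMoment 5 x = 0 := sphereMoment_of_odd (by decide) x
  have m6 : sphereMoment 6 x = 15 * r₁ ^ 6 / 13728 := by
    rw [sphereMoment_six b, hx, Fintype.card_fin]; norm_num
  have f := fun {k : ℕ} (hk : k + 2 ≤ 6) => h.fiber_moments hr₁ hr₂ hrne hX₁ hX₂ hk x
  rw [← eW₁, ← eW₂] at f
  obtain ⟨p0, q0⟩ := f (k := 0) (by omega)
  obtain ⟨p1, q1⟩ := f (k := 1) (by omega)
  obtain ⟨p2, q2⟩ := f (k := 2) (by omega)
  obtain ⟨p3, q3⟩ := f (k := 3) (by omega)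
  obtain ⟨p4, q4⟩ := f (k := 4) (by omega)
  have s5 := h.sum_moments hd hX₁ hX₂ (k := 5) (l := 0) (by omega) x
  have s6 := h.sum_moments hd hX₁ hX₂ (k := 6) (l := 0) (by omega) x
  rw [← eW₁, ← eW₂] at s5 s6
  rw [m0] at p0 q0
  rw [m1] at p1 q1
  rw [m2] at p2 q2
  rw [m3] at p3 q3
  rw [m4] at p4 q4
  rw [m5] at s5
  rw [m6] at s6
  simp only [mul_zero, pow_zero, one_mul, add_zero, mul_one] at s5 s6 p0 q0
  have key := kernel_reproducing_identity (a := 2288 / A₃) (b := 264 / A₂) hr₁.ne' hW₁.ne'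
    (by rw [eA₂]; positivity) (by rw [eA₃]; positivity) eA₂ eA₃ rfl rfl rfl rfl rfl rfl
  rw [← eA₃] at s6
  have e1 (t : ℝ) : kernelSame A₂ A₃ W₁ r₁ t = 2288 / A₃ * t ^ 3 + 264 / A₂ * t ^ 2
      + (22 / (r₁ ^ 2 * W₁) - 2288 / A₃ * r₁ ^ 4 / 8) * t
      + (1 / W₁ - 264 / A₂ * r₁ ^ 4 / 22) := by
    rw [kernelSame]; ring
  have e2 (t : ℝ) : kernelCross A₂ A₃ r₁ r₂ t = 2288 / A₃ * t ^ 3 + 264 / A₂ * t ^ 2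
      + -(2288 / A₃ * (r₁ ^ 2 * r₂ ^ 2 / 8)) * t + -(264 / A₂ * (r₁ ^ 2 * r₂ ^ 2 / 22)) := by
    rw [kernelCross]; ring
  rw [kernelSame_diag hr₁.ne', ← key]
  simp only [e1, e2, sum_mul_cubic_sq]
  simp only [pow_zero, mul_one]
  rw [p0, q0, p1, q1, p2, q2, p3, q3, p4, q4]
  linear_combination (2288 / A₃) ^ 2 * s6 + 2 * (2288 / A₃) * (264 / A₂) * s5

end Kernel

section TightDesign

variable {X₁ X₂ : Finset (EuclideanSpace ℝ (Fin 22))} {w : EuclideanSpace ℝ (Fin 22) → ℝ}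
  {r₁ r₂ : ℝ}

/-- In a Euclidean `6`-design of `2300` points on two spheres the rows of the reproducing kernel
are those of a diagonal matrix. -/
theorem IsEuclideanDesignTwoSpheres.kernel_eq_zero
    (h : IsEuclideanDesignTwoSpheres 6 X₁ X₂ w r₁ r₂) (hr₁ : 0 < r₁) (hr₂ : 0 < r₂)
    (hrne : r₁ ≠ r₂) (hX₁ : ∀ x ∈ X₁, ‖x‖ = r₁) (hX₂ : ∀ x ∈ X₂, ‖x‖ = r₂)
    (hw₁ : ∀ x ∈ X₁, 0 < w x) (hw₂ : ∀ x ∈ X₂, 0 < w x) (hcard : X₁.card + X₂.card = 2300)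
    {A₂ A₃ W₁ W₂ : ℝ} (hW₁ : 0 < W₁) (hW₂ : 0 < W₂) (eW₁ : W₁ = ∑ z ∈ X₁, w z)
    (eW₂ : W₂ = ∑ z ∈ X₂, w z)
    (eA₂ : A₂ = W₁ * r₁ ^ 4 + W₂ * r₂ ^ 4) (eA₃ : A₃ = W₁ * r₁ ^ 6 + W₂ * r₂ ^ 6) :
    (∀ x ∈ X₁, w x * kernelSame A₂ A₃ W₁ r₁ (r₁ ^ 2) = 1) ∧
    (∀ x ∈ X₂, w x * kernelSame A₂ A₃ W₂ r₂ (r₂ ^ 2) = 1) ∧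
    (∀ x ∈ X₂, ∀ z ∈ X₂, x ≠ z → kernelSame A₂ A₃ W₂ r₂ ⟪x, z⟫ = 0) ∧
    (∀ x ∈ X₂, ∀ z ∈ X₁, kernelCross A₂ A₃ r₂ r₁ ⟪x, z⟫ = 0) := by
  have hA₂ : 0 < A₂ := by rw [eA₂]; positivity
  have hA₃ : 0 < A₃ := by rw [eA₃]; positivity
  have row₁ {x} (hx : x ∈ X₁) :=
    h.sum_kernel_sq hr₁ hr₂ hrne hX₁ hX₂ hW₁ hW₂ eW₁ eW₂ eA₂ eA₃ (hX₁ x hx)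
  have row₂ {x} (hx : x ∈ X₂) :=
    h.symm.sum_kernel_sq hr₂ hr₁ hrne.symm hX₂ hX₁ hW₂ hW₁ eW₂ eW₁
      (eA₂.trans (add_comm _ _)) (eA₃.trans (add_comm _ _)) (hX₂ x hx)
  have d₁ := kernelSame_diag (A₂ := A₂) (A₃ := A₃) (W := W₁) hr₁.ne'
  have d₂ := kernelSame_diag (A₂ := A₂) (A₃ := A₃) (W := W₂) hr₂.ne'
  set k₁ := kernelSame A₂ A₃ W₁ r₁ (r₁ ^ 2) with hk₁
  set k₂ := kernelSame A₂ A₃ W₂ r₂ (r₂ ^ 2) with hk₂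
  have hk₁pos : 0 < k₁ := by rw [d₁]; positivity
  have hk₂pos : 0 < k₂ := by rw [d₂]; positivity
  have htrace : W₁ * k₁ + W₂ * k₂ = 2300 := by
    have e : W₁ * k₁ + W₂ * k₂ = 2002 * ((W₁ * r₁ ^ 6 + W₂ * r₂ ^ 6) / A₃)
        + 252 * ((W₁ * r₁ ^ 4 + W₂ * r₂ ^ 4) / A₂) + 46 := by
      rw [d₁, d₂]
      field_simp
      ring
    rw [e, ← eA₂, ← eA₃, div_self hA₂.ne', div_self hA₃.ne']
    norm_num
  have inner_self₁ {x} (hx : x ∈ X₁) : ⟪x, x⟫ = r₁ ^ 2 := by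
    rw [real_inner_self_eq_norm_sq, hX₁ x hx]
  have inner_self₂ {x} (hx : x ∈ X₂) : ⟪x, x⟫ = r₂ ^ 2 := by
    rw [real_inner_self_eq_norm_sq, hX₂ x hx]
  have nonneg₁ (g : EuclideanSpace ℝ (Fin 22) → ℝ) : ∀ z ∈ X₁, 0 ≤ w z * g z ^ 2 :=
    fun z hz => mul_nonneg (hw₁ z hz).le (sq_nonneg _)
  have nonneg₂ (g : EuclideanSpace ℝ (Fin 22) → ℝ) : ∀ z ∈ X₂, 0 ≤ w z * g z ^ 2 :=
    fun z hz => mul_nonneg (hw₂ z hz).le (sq_nonneg _)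
  have le₁ : ∀ x ∈ X₁, w x * k₁ ≤ 1 := fun x hx => by
    have a := Finset.single_le_sum (nonneg₁ fun z => kernelSame A₂ A₃ W₁ r₁ ⟪x, z⟫) hx
    have b := Finset.sum_nonneg (nonneg₂ fun z => kernelCross A₂ A₃ r₁ r₂ ⟪x, z⟫)
    have c := row₁ hx
    rw [inner_self₁ hx, ← hk₁] at a
    exact le_of_mul_le_mul_right (by nlinarith) hk₁pos
  have le₂ : ∀ x ∈ X₂, w x * k₂ ≤ 1 := fun x hx => by
    have a := Finset.single_le_sum (nonneg₂ fun z => kernelSame A₂ A₃ W₂ r₂ ⟪x, z⟫) hx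
    have b := Finset.sum_nonneg (nonneg₁ fun z => kernelCross A₂ A₃ r₂ r₁ ⟪x, z⟫)
    have c := row₂ hx
    rw [inner_self₂ hx, ← hk₂] at a
    exact le_of_mul_le_mul_right (by nlinarith) hk₂pos
  have s₁ : ∑ x ∈ X₁, (1 - w x * k₁) = X₁.card - W₁ * k₁ := by
    rw [Finset.sum_sub_distrib, ← Finset.sum_mul, ← eW₁]; simp
  have s₂ : ∑ x ∈ X₂, (1 - w x * k₂) = X₂.card - W₂ * k₂ := by
    rw [Finset.sum_sub_distrib, ← Finset.sum_mul, ← eW₂]; simp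
  have p₁ := Finset.sum_nonneg fun x hx => sub_nonneg.2 (le₁ x hx)
  have p₂ := Finset.sum_nonneg fun x hx => sub_nonneg.2 (le₂ x hx)
  have hN : (X₁.card : ℝ) + X₂.card = 2300 := by exact_mod_cast hcard
  have eq₁ : ∀ x ∈ X₁, w x * k₁ = 1 := fun x hx => by
    have := (Finset.sum_eq_zero_iff_of_nonneg fun x hx => sub_nonneg.2 (le₁ x hx)).1
      (by linarith) x hx
    linarith
  have eq₂ : ∀ x ∈ X₂, w x * k₂ = 1 := fun x hx => by
    have := (Finset.sum_eq_zero_iff_of_nonneg fun x hx => sub_nonneg.2 (le₂ x hx)).1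
      (by linarith) x hx
    linarith
  refine ⟨eq₁, eq₂, fun x hx z hz hxz => ?_, fun x hx z hz => ?_⟩
  · have a := Finset.add_le_sum (nonneg₂ fun z => kernelSame A₂ A₃ W₂ r₂ ⟪x, z⟫) hx hz hxz
    have b := Finset.sum_nonneg (nonneg₁ fun z => kernelCross A₂ A₃ r₂ r₁ ⟪x, z⟫)
    have c := row₂ hx
    rw [inner_self₂ hx, ← hk₂] at a
    have e : w x * k₂ ^ 2 = k₂ := by linear_combination k₂ * eq₂ x hx
    have z0 : w z * kernelSame A₂ A₃ W₂ r₂ ⟪x, z⟫ ^ 2 = 0 :=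
      le_antisymm (by linarith) (nonneg₂ (fun z => kernelSame A₂ A₃ W₂ r₂ ⟪x, z⟫) z hz)
    simpa [(hw₂ z hz).ne'] using z0
  · have a := Finset.single_le_sum (nonneg₂ fun z => kernelSame A₂ A₃ W₂ r₂ ⟪x, z⟫) hx
    have b := Finset.single_le_sum (nonneg₁ fun z => kernelCross A₂ A₃ r₂ r₁ ⟪x, z⟫) hz
    have c := row₂ hx
    rw [inner_self₂ hx, ← hk₂] at a
    have e : w x * k₂ ^ 2 = k₂ := by linear_combination k₂ * eq₂ x hx
    have z0 : w z * kernelCross A₂ A₃ r₂ r₁ ⟪x, z⟫ ^ 2 = 0 :=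
      le_antisymm (by linarith) (nonneg₁ (fun z => kernelCross A₂ A₃ r₂ r₁ ⟪x, z⟫) z hz)
    simpa [(hw₁ z hz).ne'] using z0

/-- Unweighted first and second moments of a fiber on which the weight is constant. -/
theorem IsEuclideanDesignTwoSpheres.sum_inner_div
    (h : IsEuclideanDesignTwoSpheres 6 X₁ X₂ w r₁ r₂) (hr₁ : 0 < r₁) (hr₂ : 0 < r₂)
    (hrne : r₁ ≠ r₂) (hX₁ : ∀ x ∈ X₁, ‖x‖ = r₁) (hX₂ : ∀ x ∈ X₂, ‖x‖ = r₂)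
    {k s : ℝ} (hk : ∀ z ∈ X₁, w z * k = 1) (hs : 0 < s) {x : EuclideanSpace ℝ (Fin 22)}
    (hx : ‖x‖ = s) :
    ∑ z ∈ X₁, ⟪x, z⟫ / (s * r₁) = 0 ∧
      ∑ z ∈ X₁, (⟪x, z⟫ / (s * r₁)) ^ 2 = X₁.card / 22 := by
  have m1 : sphereMoment 1 x = 0 := sphereMoment_of_odd (by decide) x
  have m2 : sphereMoment 2 x = s ^ 2 / 22 := by
    rw [sphereMoment_two (EuclideanSpace.basisFun (Fin 22) ℝ), hx, Fintype.card_fin]; norm_num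
  obtain ⟨p1, -⟩ := h.fiber_moments hr₁ hr₂ hrne hX₁ hX₂ (k := 1) (by omega) x
  obtain ⟨p2, -⟩ := h.fiber_moments hr₁ hr₂ hrne hX₁ hX₂ (k := 2) (by omega) x
  have unweight (g : EuclideanSpace ℝ (Fin 22) → ℝ) :
      ∑ z ∈ X₁, g z = k * ∑ z ∈ X₁, w z * g z := by
    rw [Finset.mul_sum]
    exact Finset.sum_congr rfl fun z hz => by linear_combination -g z * hk z hz
  have hW : k * ∑ z ∈ X₁, w z = X₁.card := by
    have := unweight fun _ => 1
    simpa using this.symm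
  simp only [div_pow, ← Finset.sum_div]
  rw [m1] at p1
  rw [m2] at p2
  constructor
  · have := unweight fun z => ⟪x, z⟫ ^ 1
    rw [p1, mul_zero, mul_zero] at this
    simp only [pow_one] at this
    rw [this, zero_div]
  · rw [unweight fun z => ⟪x, z⟫ ^ 2, p2, ← hW]
    field_simp

/-- The number of points at the root of smallest absolute value is the reciprocal of a Christoffel
number lying in `(175, 176]`, hence equals `176`. -/
theorem sq_eq_of_cubic_roots {ι : Type*} {X : Finset ι} {c : ι → ℝ} {κ : ℝ} (hκ : 0 < κ)
    (hκ' : κ ^ 2 < 143 / 1352) (hcard : X.card = 275) (h1 : ∑ z ∈ X, c z = 0)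
    (h2 : ∑ z ∈ X, c z ^ 2 = 25 / 2)
    (hc : ∀ z ∈ X, c z ^ 3 - c z / 8 + κ * (c z ^ 2 - 1 / 22) = 0) : κ ^ 2 = 9 / 176 := by
  obtain ⟨s, hs0, hs⟩ : ∃ s : ℝ, 0 < s ∧ s ^ 2 = 1 / 88 :=
    ⟨√(1 / 88), by positivity, Real.sq_sqrt (by positivity)⟩
  obtain ⟨t, ⟨ht1, ht2⟩, ht⟩ : ∃ t ∈ Set.Ioo (-s) 0, t ^ 3 - t / 8 + κ * (t ^ 2 - 1 / 22) = 0 := by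
    have hcont : ContinuousOn (fun t : ℝ => t ^ 3 - t / 8 + κ * (t ^ 2 - 1 / 22))
        (Set.Icc (-s) 0) := by fun_prop
    refine intermediate_value_Ioo' (by linarith) hcont ⟨?_, ?_⟩
    · norm_num
      exact hκ
    · have e : (-s) ^ 3 - -s / 8 + κ * ((-s) ^ 2 - 1 / 22) = (10 * s - 3 * κ) / 88 := by
        linear_combination (-s + κ) * hs
      rw [e]
      have : 3 * κ < 10 * s := by
        refine lt_of_pow_lt_pow_left₀ 2 (by positivity) ?_
        rw [mul_pow, mul_pow, hs]
        linarith
      linarith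
  have hT : t ^ 2 < 1 / 88 := by nlinarith
  have hT0 : 0 < t ^ 2 := by nlinarith
  have hfac : ∀ z ∈ X, c z ≠ t →
      7 + 154 * t * c z + 1936 * (t ^ 2 - 1 / 22) * (c z ^ 2 - 1 / 22) = 0 := fun z hz hne => by
    apply mul_left_cancel₀ (sub_ne_zero.2 hne)
    linear_combination 1936 * (t ^ 2 - 1 / 22) * hc z hz - 1936 * (c z ^ 2 - 1 / 22) * ht
  have hsum : ∑ z ∈ X, (7 + 154 * t * c z + 1936 * (t ^ 2 - 1 / 22) * (c z ^ 2 - 1 / 22))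
      = 1925 := by
    rw [Finset.sum_add_distrib, Finset.sum_add_distrib, ← Finset.mul_sum, ← Finset.mul_sum,
      Finset.sum_sub_distrib, h1, h2]
    simp only [Finset.sum_const, hcard, nsmul_eq_mul]
    norm_num
  have hcount : ((X.filter fun z => c z = t).card : ℝ)
      * (7 + 154 * t * t + 1936 * (t ^ 2 - 1 / 22) * (t ^ 2 - 1 / 22)) = 1925 := by
    rw [← hsum, ← Finset.sum_filter_add_sum_filter_not X fun z => c z = t,
      Finset.sum_eq_zero (s := X.filter fun z => ¬ c z = t) fun z hz =>
        hfac z (Finset.mem_filter.1 hz).1 (Finset.mem_filter.1 hz).2, add_zero,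
      ← nsmul_eq_mul, ← Finset.sum_const]
    exact Finset.sum_congr rfl fun z hz => by rw [(Finset.mem_filter.1 hz).2]
  set m := (X.filter fun z => c z = t).card
  have hq : (m : ℝ) * (176 * (t ^ 2) ^ 2 - 2 * t ^ 2 + 1) = 175 := by
    linear_combination hcount / 11
  have hlo : 175 < m := by
    by_contra! hle
    have : (m : ℝ) ≤ 175 := by exact_mod_cast hle
    nlinarith [mul_pos hT0 (sub_pos.2 hT), sq_nonneg (176 * t ^ 2 - 1)]
  have hhi : m ≤ 176 := by
    have : (m : ℝ) ≤ 176 := by nlinarith [sq_nonneg (176 * t ^ 2 - 1), Nat.cast_nonneg (α := ℝ) m]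
    exact_mod_cast this
  have hm : m = 176 := by omega
  rw [hm] at hq
  have hT' : t ^ 2 = 1 / 176 := by
    have : (176 * t ^ 2 - 1) ^ 2 = 0 := by push_cast at hq; linear_combination hq
    have := pow_eq_zero_iff (two_ne_zero) |>.1 this
    linarith
  have hκt : κ = -3 * t := by
    linear_combination (-176 / 7 : ℝ) * ht + (176 / 7 * t + 176 / 7 * κ) * hT'
  rw [hκt, mul_pow, hT']
  norm_num

end TightDesign

/-- the normalized inner products between distinct points of the fiber `X₂`
form the set `{7/22, -1/44, -4/11}`; in particular `X₂` is a 3-distance set. -/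
theorem statement3
    {X₁ X₂ : Finset (EuclideanSpace ℝ (Fin 22))} {w : EuclideanSpace ℝ (Fin 22) → ℝ}
    {r₁ r₂ : ℝ} (hr₁ : 0 < r₁) (hr₂ : 0 < r₂) (hrne : r₁ ≠ r₂)
    (hX₁ : ∀ x ∈ X₁, ‖x‖ = r₁) (hX₂ : ∀ x ∈ X₂, ‖x‖ = r₂)
    (hw : ∀ x ∈ X₁ ∪ X₂, 0 < w x)
    (hcard : (X₁ ∪ X₂).card = 2300) (hcard₁ : X₁.card = 275)
    (hdesign : IsEuclideanDesignTwoSpheres 6 X₁ X₂ w r₁ r₂) :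
    {a : ℝ | ∃ x ∈ X₂, ∃ y ∈ X₂, x ≠ y ∧ ⟪x, y⟫ / (r₂ * r₂) = a}
      = {7 / 22, -(1 / 44), -(4 / 11)} := by
  have hd := disjoint_of_norm_eq hrne hX₁ hX₂
  have hcards : X₁.card + X₂.card = 2300 := by rw [← Finset.card_union_of_disjoint hd, hcard]
  have hcard₂ : X₂.card = 2025 := by omega
  have hw₁ : ∀ x ∈ X₁, 0 < w x := fun x hx => hw x (Finset.mem_union_left _ hx)
  have hw₂ : ∀ x ∈ X₂, 0 < w x := fun x hx => hw x (Finset.mem_union_right _ hx)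
  have ne₁ : X₁.Nonempty := Finset.card_pos.1 (by omega)
  have ne₂ : X₂.Nonempty := Finset.card_pos.1 (by omega)
  obtain ⟨W₁, eW₁⟩ : ∃ W, W = ∑ z ∈ X₁, w z := ⟨_, rfl⟩
  obtain ⟨W₂, eW₂⟩ : ∃ W, W = ∑ z ∈ X₂, w z := ⟨_, rfl⟩
  have hW₁ : 0 < W₁ := eW₁ ▸ Finset.sum_pos hw₁ ne₁
  have hW₂ : 0 < W₂ := eW₂ ▸ Finset.sum_pos hw₂ ne₂
  obtain ⟨A₂, eA₂⟩ : ∃ A, A = W₁ * r₁ ^ 4 + W₂ * r₂ ^ 4 := ⟨_, rfl⟩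
  obtain ⟨A₃, eA₃⟩ : ∃ A, A = W₁ * r₁ ^ 6 + W₂ * r₂ ^ 6 := ⟨_, rfl⟩
  have hA₂ : 0 < A₂ := by rw [eA₂]; positivity
  have hA₃ : 0 < A₃ := by rw [eA₃]; positivity
  obtain ⟨c₁, c₂, hsame, hcross⟩ := hdesign.kernel_eq_zero hr₁ hr₂ hrne hX₁ hX₂ hw₁ hw₂ hcards
    hW₁ hW₂ eW₁ eW₂ eA₂ eA₃
  obtain ⟨x₀, hx₀⟩ := ne₂
  obtain ⟨a₂, ea₂⟩ : ∃ a, a = W₂ * r₂ ^ 4 / A₂ := ⟨_, rfl⟩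
  obtain ⟨a₃, ea₃⟩ : ∃ a, a = W₂ * r₂ ^ 6 / A₃ := ⟨_, rfl⟩
  have eb₂ : 1 - a₂ = W₁ * r₁ ^ 4 / A₂ := by
    rw [ea₂, eq_div_iff hA₂.ne', sub_mul, div_mul_cancel₀ _ hA₂.ne']; linarith
  have eb₃ : 1 - a₃ = W₁ * r₁ ^ 6 / A₃ := by
    rw [ea₃, eq_div_iff hA₃.ne', sub_mul, div_mul_cancel₀ _ hA₃.ne']; linarith
  have ha₂ : 0 < a₂ := by rw [ea₂]; positivity
  have hb₂ : 0 < 1 - a₂ := by rw [eb₂]; positivity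
  have hlin : 2002 * a₃ + 252 * a₂ = 2002 := by
    have hs : W₂ * kernelSame A₂ A₃ W₂ r₂ (r₂ ^ 2) = 2025 := by
      nth_rw 1 [eW₂]
      rw [Finset.sum_mul, Finset.sum_congr rfl c₂]
      simp [hcard₂]
    rw [kernelSame_diag hr₂.ne'] at hs
    have e : W₂ * (2002 * r₂ ^ 6 / A₃ + 252 * r₂ ^ 4 / A₂ + 23 / W₂)
        = 2002 * a₃ + 252 * a₂ + 23 := by
      rw [ea₂, ea₃]
      field_simp
    linarith
  obtain ⟨κ, eκ⟩ : ∃ κ, κ = 3 * A₃ / (26 * A₂ * r₁ * r₂) := ⟨_, rfl⟩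
  have hκ : 0 < κ := by rw [eκ]; positivity
  have hκrel : κ ^ 2 * (a₃ * (1 - a₃)) = 9 / 676 * (a₂ * (1 - a₂)) := by
    rw [eb₂, eb₃, ea₂, ea₃, eκ]
    field_simp
    norm_num
  have hκrel' : κ ^ 2 * (143 - 18 * a₂) * 18 = 9 / 676 * (1 - a₂) * 143 ^ 2 := by
    apply mul_left_cancel₀ ha₂.ne'
    have : a₃ = 1 - 18 / 143 * a₂ := by linarith
    rw [this] at hκrel
    linear_combination 143 ^ 2 * hκrel
  have hκlt : κ ^ 2 < 143 / 1352 := by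
    refine lt_of_mul_lt_mul_right (a := 18 * (143 - 18 * a₂)) ?_ (by linarith)
    linarith
  have hκsq : κ ^ 2 = 9 / 176 := by
    obtain ⟨h1, h2⟩ := hdesign.sum_inner_div hr₁ hr₂ hrne hX₁ hX₂ c₁ hr₂ (hX₂ x₀ hx₀)
    refine sq_eq_of_cubic_roots hκ hκlt hcard₁ h1 ?_ fun z hz => ?_
    · rw [h2, hcard₁]; norm_num
    · have hz0 := hcross x₀ hx₀ z hz
      obtain ⟨c, hc⟩ : ∃ c, c = ⟪x₀, z⟫ / (r₂ * r₁) := ⟨_, rfl⟩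
      have hc' : ⟪x₀, z⟫ = c * (r₂ * r₁) := by rw [hc]; field_simp
      rw [← hc]
      rw [hc', kernelCross] at hz0
      have : c ^ 3 - c / 8 + κ * (c ^ 2 - 1 / 22) = A₃ / (2288 * (r₂ * r₁) ^ 3) *
          (2288 / A₃ * ((c * (r₂ * r₁)) ^ 3 - r₂ ^ 2 * r₁ ^ 2 / 8 * (c * (r₂ * r₁)))
            + 264 / A₂ * ((c * (r₂ * r₁)) ^ 2 - r₂ ^ 2 * r₁ ^ 2 / 22)) := by
        rw [eκ]
        field_simp
        ring
      rw [this, hz0, mul_zero]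
  have ha₂' : a₂ = 11 / 20 := by rw [hκsq] at hκrel'; linarith
  have ha₃' : a₃ = 121 / 130 := by linarith
  have hroot : ∀ x ∈ X₂, ∀ z ∈ X₂, x ≠ z → (⟪x, z⟫ / (r₂ * r₂) - 7 / 22)
      * (⟪x, z⟫ / (r₂ * r₂) + 1 / 44) * (⟪x, z⟫ / (r₂ * r₂) + 4 / 11) = 0 := by
    intro x hx z hz hxz
    have hz0 := hsame x hx z hz hxz
    obtain ⟨c, hc⟩ : ∃ c, c = ⟪x, z⟫ / (r₂ * r₂) := ⟨_, rfl⟩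
    have hc' : ⟪x, z⟫ = c * (r₂ * r₂) := by rw [hc]; field_simp
    rw [← hc]
    rw [hc', kernelSame] at hz0
    have : 2288 * a₃ * (c ^ 3 - c / 8) + 264 * a₂ * (c ^ 2 - 1 / 22) + 22 * c + 1 = W₂ *
        (2288 / A₃ * ((c * (r₂ * r₂)) ^ 3 - r₂ ^ 4 / 8 * (c * (r₂ * r₂)))
          + 264 / A₂ * ((c * (r₂ * r₂)) ^ 2 - r₂ ^ 4 / 22)
          + 22 / (r₂ ^ 2 * W₂) * (c * (r₂ * r₂)) + 1 / W₂) := by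
      rw [ea₂, ea₃]
      field_simp
    rw [hz0, mul_zero, ha₂', ha₃'] at this
    linear_combination this * (5 / 10648)
  obtain ⟨h1, h2⟩ := hdesign.symm.sum_inner_div hr₂ hr₁ hrne.symm hX₂ hX₁ c₂ hr₂ (hX₂ x₀ hx₀)
  have hself : ⟪x₀, x₀⟫ / (r₂ * r₂) = 1 := by
    rw [real_inner_self_eq_norm_mul_norm, hX₂ x₀ hx₀, div_self (by positivity)]
  have attained {α β γ : ℝ} (hp : ∀ c : ℝ, (c - 7 / 22) * (c + 1 / 44) * (c + 4 / 11)
      = (c - α) * (c - β) * (c - γ))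
      (hne : 2025 * (1 / 22 + β * γ) ≠ (1 - β) * (1 - γ)) :
      ∃ x ∈ X₂, ∃ y ∈ X₂, x ≠ y ∧ ⟪x, y⟫ / (r₂ * r₂) = α := by
    by_contra! hcon
    apply hne
    have hsum : ∑ z ∈ X₂, (⟪x₀, z⟫ / (r₂ * r₂) - β) * (⟪x₀, z⟫ / (r₂ * r₂) - γ)
        = 2025 * (1 / 22 + β * γ) := by
      have e (c : ℝ) : (c - β) * (c - γ) = c ^ 2 - (β + γ) * c + β * γ := by ring
      simp only [e]
      rw [Finset.sum_add_distrib, Finset.sum_sub_distrib, ← Finset.mul_sum, h1, h2]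
      simp only [Finset.sum_const, hcard₂, nsmul_eq_mul]
      push_cast
      ring
    rw [← hsum, Finset.sum_eq_single_of_mem x₀ hx₀, hself]
    intro z hz hzx
    have := hroot x₀ hx₀ z hz hzx.symm
    rw [hp, mul_assoc] at this
    exact (mul_eq_zero.1 this).resolve_left (sub_ne_zero.2 (hcon x₀ hx₀ z hz hzx.symm))
  ext a
  simp only [Set.mem_ofPred_eq, Set.mem_insert_iff, Set.mem_singleton_iff]
  constructor
  · rintro ⟨x, hx, y, hy, hxy, rfl⟩
    rcases mul_eq_zero.1 (hroot x hx y hy hxy) with h | h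
    · rcases mul_eq_zero.1 h with h | h
      · left; linarith
      · right; left; linarith
    · right; right; linarith
  · rintro (rfl | rfl | rfl)
    · exact attained (β := -(1 / 44)) (γ := -(4 / 11)) (fun c => by ring) (by norm_num)
    · exact attained (β := 7 / 22) (γ := -(4 / 11)) (fun c => by ring) (by norm_num)
    · exact attained (β := 7 / 22) (γ := -(1 / 44)) (fun c => by ring) (by norm_num)
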